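/- If two sequences s, t in {0,1,2}^N satisfy s_k != 2 and t_k != 2 for all k in some set A, and s != t, then the reals x = sum_k s_k 3^(-(k+1)) and y = sum_k t_k 3^(-(k+1)) are distinct whenever the sequences differ; i.e., the base-3 representation map is injective on sequences avoiding digit 2 at positions 3k+2 (k in N). -/

import Mathlib

-- The ternary ultrametric `δ₃` on ternary sequences.
open Classical in
noncomputable def delta3 (s t : ℕ → Fin 3) : ℝ :=
  if h : s = t then 0
  else (3 : ℝ) ^ (-(Nat.find (show ∃ k, s k ≠ t k by
    by_contra hc; push_neg at hc; exact h (funext hc)) : ℤ))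

-- The real number represented in base 3 by a ternary digit sequence.
noncomputable def val3 (s : ℕ → Fin 3) : ℝ := ∑' k, (s k : ℝ) / 3 ^ (k + 1)

theorem val3_eq_ofDigits (s : ℕ → Fin 3) : val3 s = Real.ofDigits s := by
  simp [val3, Real.ofDigits, Real.ofDigitsTerm, div_eq_mul_inv]

theorem ofDigits_lt_one_of_ne_last {b : ℕ} (hb : 1 < b) {a : ℕ → Fin b} {m : ℕ}
    (hm : (a m : ℕ) < b - 1) : Real.ofDigits a < 1 := by
  rw [← Real.ofDigits_const_last_eq_one' hb]
  have hb0 : (0 : ℝ) < b := by positivity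
  refine Summable.tsum_lt_tsum (i := m) (fun k => ?_) ?_ Real.summable_ofDigitsTerm
    Real.summable_ofDigitsTerm
  · have : (a k : ℕ) ≤ b - 1 := by have := (a k).isLt; omega
    simp only [Real.ofDigitsTerm]
    gcongr
  · simp only [Real.ofDigitsTerm]
    gcongr

theorem ofDigits_lt_ofDigits {b : ℕ} (hb : 1 < b) {x y : ℕ → Fin b} {n m : ℕ}
    (hxy : ∀ i < n, x i = y i) (hn : x n < y n) (hnm : n < m) (hm : (x m : ℕ) < b - 1) :
    Real.ofDigits x < Real.ofDigits y := by
  have hb0 : (0 : ℝ) < b := by positivity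
  rw [Real.ofDigits_eq_sum_add_ofDigits x (n + 1), Real.ofDigits_eq_sum_add_ofDigits y (n + 1),
    Finset.sum_range_succ, Finset.sum_range_succ]
  have hsum : ∑ i ∈ Finset.range n, Real.ofDigitsTerm x i =
      ∑ i ∈ Finset.range n, Real.ofDigitsTerm y i :=
    Finset.sum_congr rfl fun i hi => by
      simp [Real.ofDigitsTerm, hxy i (Finset.mem_range.mp hi)]
  have hx : Real.ofDigits (fun i => x (i + (n + 1))) < 1 :=
    ofDigits_lt_one_of_ne_last hb (m := m - (n + 1)) (by
      rwa [Nat.sub_add_cancel hnm])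
  have hy := Real.ofDigits_nonneg (fun i => y (i + (n + 1)))
  have hd : ((x n : ℕ) : ℝ) + 1 ≤ (y n : ℕ) := by exact_mod_cast hn
  have hpos : (0 : ℝ) < ((b : ℝ) ^ (n + 1))⁻¹ := by positivity
  have hdc := mul_le_mul_of_nonneg_right hd hpos.le
  have hxc := mul_lt_mul_of_pos_left hx hpos
  have hyc := mul_nonneg hpos.le hy
  rw [hsum]
  simp only [Real.ofDigitsTerm]
  linarith

theorem val3_lt_val3 {s t : ℕ → Fin 3} (hs : ∀ k, s (3 * k + 2) ≠ 2) {n : ℕ}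
    (hst : ∀ i < n, s i = t i) (hn : s n < t n) : val3 s < val3 t := by
  rw [val3_eq_ofDigits, val3_eq_ofDigits]
  refine ofDigits_lt_ofDigits (by norm_num) hst hn (m := 3 * n + 2) (by omega) ?_
  have := hs n
  omega

theorem stmt_4 (s t : ℕ → Fin 3)
    (hs : ∀ k, s (3 * k + 2) ≠ 2) (ht : ∀ k, t (3 * k + 2) ≠ 2)
    (hst : s ≠ t) :
    val3 s ≠ val3 t := by
  classical
  have hex : ∃ k, s k ≠ t k := Function.ne_iff.mp hst
  have hpre : ∀ i < Nat.find hex, s i = t i := fun i hi => not_not.mp (Nat.find_min hex hi)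
  rcases lt_or_gt_of_ne (Nat.find_spec hex) with h | h
  · exact (val3_lt_val3 hs hpre h).ne
  · exact (val3_lt_val3 ht (fun i hi => (hpre i hi).symm) h).ne'
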